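/- arXiv:1804.06617 — 2 statements merged into one kernel-verified Lean document; each statement's English description precedes it below -/
import Mathlib

section
/- If A is a bijective skew PBW extension over R, where A and R are algebras over a commutative ring k, then A^e = A ⊗_k A^{op} is a free left R ⊗_k R^{op}-module with basis Mon(A^e) = {(x_1⊗1)^{α_1}···(x_n⊗1)^{α_n}(1⊗x_n)^{α_{n+1}}···(1⊗x_1)^{α_{2n}} : (α_1,…,α_{2n}) ∈ ℕ^{2n}}. -/
open scoped TensorProduct
open MulOpposite

noncomputable section

/-- The standard monomial `x₁^{α₁} ⋯ xₙ^{αₙ}` (ordered product). -/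
def spbwMon {A : Type*} [Ring A] {n : ℕ} (x : Fin n → A) (α : Fin n → ℕ) : A :=
  (List.ofFn fun i => x i ^ α i).prod

/-- The set `R + R x₁ + ⋯ + R xₙ` inside `A`. -/
def spbwSpan {R A : Type*} [Ring R] [Ring A] {n : ℕ} (ι : R →+* A) (x : Fin n → A) :
    Set A :=
  {a : A | ∃ (r₀ : R) (c : Fin n → R), a = ι r₀ + ∑ l, ι (c l) * x l}

/-- `A` is a skew PBW extension over `R` (embedded in `A` via `ι`) with
generators `x₁, …, xₙ`. -/
structure IsSkewPBWExtension {R A : Type*} [Ring R] [Ring A] {n : ℕ}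
    (ι : R →+* A) (x : Fin n → A) : Prop where
  /-- (i) `R ⊆ A`. -/
  inj : Function.Injective ι
  /-- (ii) `A` is a free left `R`-module with basis the standard monomials. -/
  repr_unique : ∀ f : A, ∃! c : (Fin n → ℕ) →₀ R,
    f = c.sum fun α r => ι r * spbwMon x α
  /-- (iii) `xᵢ r − c_{i,r} xᵢ ∈ R`. -/
  mul_coeff : ∀ (i : Fin n) (r : R), r ≠ 0 → ∃ c : R, c ≠ 0 ∧
    x i * ι r - ι c * x i ∈ Set.range ι
  /-- (iv) `xⱼ xᵢ − c_{i,j} xᵢ xⱼ ∈ R + R x₁ + ⋯ + R xₙ`. -/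
  mul_gen : ∀ i j : Fin n, ∃ c : R, c ≠ 0 ∧
    x j * x i - ι c * (x i * x j) ∈ spbwSpan ι x

/-- `δ` is a `σ`-derivation: additive and `δ(rs) = σ(r)δ(s) + δ(r)s`. -/
def IsSigmaDerivation {R : Type*} [Ring R] (σ : R → R) (δ : R → R) : Prop :=
  (∀ r s : R, δ (r + s) = δ r + δ s) ∧ ∀ r s : R, δ (r * s) = σ r * δ s + δ r * s

/-- `A` is a *bijective* skew PBW extension over `R` via `ι` with generators
`x`. -/
def IsBijectiveSkewPBWExtension {R A : Type*} [Ring R] [Ring A] {n : ℕ}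
    (ι : R →+* A) (x : Fin n → A) : Prop :=
  IsSkewPBWExtension ι x ∧
  ∃ (σ : Fin n → R ≃+* R) (δ : Fin n → R → R) (c : Fin n → Fin n → R),
    (∀ i, IsSigmaDerivation (σ i) (δ i)) ∧
    (∀ (i : Fin n) (r : R), x i * ι r = ι (σ i r) * x i + ι (δ i r)) ∧
    (∀ i j : Fin n, x j * x i - ι (c i j) * (x i * x j) ∈ spbwSpan ι x) ∧
    (∀ i j : Fin n, i < j → IsUnit (c i j))

section Monomials

variable {A : Type*} [Ring A]

theorem spbwMon_cons {n : ℕ} (x : Fin (n + 1) → A) (a : ℕ) (α : Fin n → ℕ) :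
    spbwMon x (Fin.cons a α : Fin (n + 1) → ℕ) = x 0 ^ a * spbwMon (Fin.tail x) α := by
  simp [spbwMon, List.ofFn_succ, Fin.tail]

theorem map_spbwMon {B : Type*} [Ring B] (f : A →+* B) {n : ℕ} (x : Fin n → A)
    (α : Fin n → ℕ) : f (spbwMon x α) = spbwMon (fun i => f (x i)) α := by
  simp [spbwMon, map_list_prod, List.map_ofFn, Function.comp_def]

theorem spbwMon_append {m n : ℕ} (x : Fin m → A) (y : Fin n → A) (α : Fin m → ℕ)
    (β : Fin n → ℕ) :
    spbwMon (Fin.append x y) (Fin.append α β) = spbwMon x α * spbwMon y β := by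
  have : (fun i => Fin.append x y i ^ Fin.append α β i) =
      Fin.append (fun i => x i ^ α i) (fun i => y i ^ β i) := by
    ext i
    refine Fin.addCases (fun i => ?_) (fun i => ?_) i <;> simp
  rw [spbwMon, this, List.ofFn_fin_append, List.prod_append]
  rfl

theorem spbwMon_op_rev {n : ℕ} (x : Fin n → A) (α : Fin n → ℕ) :
    spbwMon (fun i => op (x i.rev)) (fun i => α i.rev) = op (spbwMon x α) := by
  have : (List.ofFn fun i : Fin n => op (x i.rev) ^ α i.rev) =
      ((List.ofFn fun i => x i ^ α i).map op).reverse := by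
    refine List.ext_getElem (by simp) fun i h₁ h₂ => ?_
    simp only [List.length_ofFn] at h₁
    simp only [List.getElem_ofFn, List.getElem_reverse, List.getElem_map, List.length_map,
      List.length_ofFn, op_pow]
    have e : (Fin.mk i h₁).rev = ⟨n - 1 - i, by omega⟩ := by
      ext
      simp only [Fin.val_rev]
      omega
    rw [e]
  rw [spbwMon, this, spbwMon, op_list_prod]

/-- The additive subgroup generated by the elements `r x^β` with `β < α`. -/
def spbwLower {R : Type*} [Ring R] (ι : R →+* A) {n : ℕ} (x : Fin n → A) (α : Fin n → ℕ) :
    AddSubgroup A :=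
  AddSubgroup.closure {a | ∃ β < α, ∃ r, a = ι r * spbwMon x β}

variable {R : Type*} [Ring R] {ι : R →+* A}

theorem exists_pow_mul_sub_mem {y : A} (σ : R ≃+* R) (δ : R → R)
    (h : ∀ r, y * ι r = ι (σ r) * y + ι (δ r)) (a : ℕ) :
    ∃ τ : R ≃+ R, ∀ r, y ^ a * ι r - ι (τ r) * y ^ a ∈
      AddSubgroup.closure {b | ∃ j < a, ∃ s, b = ι s * y ^ j} := by
  induction a with
  | zero => exact ⟨AddEquiv.refl R, fun r => by simp⟩
  | succ a ih =>
    obtain ⟨τ, hτ⟩ := ih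
    refine ⟨τ.trans σ.toAddEquiv, fun r => ?_⟩
    have key : ∀ b ∈ AddSubgroup.closure {b | ∃ j < a, ∃ s, b = ι s * y ^ j},
        y * b ∈ AddSubgroup.closure {b | ∃ j < a + 1, ∃ s, b = ι s * y ^ j} := by
      intro b hb
      induction hb using AddSubgroup.closure_induction with
      | mem b hb =>
        obtain ⟨j, hj, s, rfl⟩ := hb
        rw [← mul_assoc, h, add_mul, mul_assoc, ← pow_succ']
        exact add_mem (AddSubgroup.subset_closure ⟨j + 1, by omega, _, rfl⟩)
          (AddSubgroup.subset_closure ⟨j, by omega, _, rfl⟩)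
      | zero => simp
      | add b c _ _ hb hc => rw [mul_add]; exact add_mem hb hc
      | neg b _ hb => rw [mul_neg]; exact neg_mem hb
    have e : y ^ (a + 1) * ι r - ι (τ.trans σ.toAddEquiv r) * y ^ (a + 1) =
        y * (y ^ a * ι r - ι (τ r) * y ^ a) + ι (δ (τ r)) * y ^ a := by
      have : y * (ι (τ r) * y ^ a) =
          ι (σ (τ r)) * y ^ (a + 1) + ι (δ (τ r)) * y ^ a := by
        rw [← mul_assoc, h, add_mul, mul_assoc, ← pow_succ']
      rw [mul_sub, this, ← mul_assoc, ← pow_succ', sub_add_eq_sub_sub, sub_add_cancel]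
      rfl
    rw [e]
    exact add_mem (key _ (hτ r)) (AddSubgroup.subset_closure ⟨a, by omega, _, rfl⟩)

/-- Moving a coefficient from the right to the left of a standard monomial changes it by an
additive bijection, up to strictly smaller monomials. -/
theorem exists_spbwMon_mul_sub_mem_spbwLower {n : ℕ} (x : Fin n → A) (σ : Fin n → R ≃+* R)
    (δ : Fin n → R → R) (h : ∀ i r, x i * ι r = ι (σ i r) * x i + ι (δ i r))
    (α : Fin n → ℕ) :
    ∃ τ : R ≃+ R, ∀ r, spbwMon x α * ι r - ι (τ r) * spbwMon x α ∈ spbwLower ι x α := by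
  induction n with
  | zero => exact ⟨AddEquiv.refl R, fun r => by simp [spbwMon]⟩
  | succ n ih =>
    obtain ⟨a, α, rfl⟩ : ∃ a β, α = (Fin.cons a β : Fin (n + 1) → ℕ) :=
      ⟨α 0, Fin.tail α, (Fin.cons_self_tail α).symm⟩
    obtain ⟨τ, hτ⟩ := ih (Fin.tail x) (Fin.tail σ) (Fin.tail δ) (fun i r => h i.succ r) α
    obtain ⟨ρ, hρ⟩ := exists_pow_mul_sub_mem (σ 0) (δ 0) (h 0) a
    have lower_of_le : ∀ β ≤ α, ∀ b ∈ AddSubgroup.closure {b | ∃ j < a, ∃ s, b = ι s * x 0 ^ j},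
        b * spbwMon (Fin.tail x) β ∈ spbwLower ι x (Fin.cons a α : Fin (n + 1) → ℕ) := by
      intro β hβ b hb
      induction hb using AddSubgroup.closure_induction with
      | mem b hb =>
        obtain ⟨j, hj, s, rfl⟩ := hb
        refine AddSubgroup.subset_closure ⟨Fin.cons j β, ?_, s, ?_⟩
        · refine lt_of_le_of_ne (Fin.cons_le_cons.2 ⟨hj.le, hβ⟩) fun e => ?_
          exact hj.ne (Fin.cons_inj.1 e).1
        · rw [spbwMon_cons, mul_assoc]
      | zero => simp
      | add b c _ _ hb hc => rw [add_mul]; exact add_mem hb hc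
      | neg b _ hb => rw [neg_mul]; exact neg_mem hb
    have pow_mul_lower : ∀ b ∈ spbwLower ι (Fin.tail x) α,
        x 0 ^ a * b ∈ spbwLower ι x (Fin.cons a α : Fin (n + 1) → ℕ) := by
      intro b hb
      induction hb using AddSubgroup.closure_induction with
      | mem b hb =>
        obtain ⟨β, hβ, s, rfl⟩ := hb
        have e : x 0 ^ a * (ι s * spbwMon (Fin.tail x) β) =
            (x 0 ^ a * ι s - ι (ρ s) * x 0 ^ a) * spbwMon (Fin.tail x) β +
              ι (ρ s) * (x 0 ^ a * spbwMon (Fin.tail x) β) := by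
          noncomm_ring
        rw [e]
        refine add_mem (lower_of_le β hβ.le _ (hρ s))
          (AddSubgroup.subset_closure ⟨Fin.cons a β, ?_, ρ s, ?_⟩)
        · refine lt_of_le_of_ne (Fin.cons_le_cons.2 ⟨le_rfl, hβ.le⟩) fun e => ?_
          exact hβ.ne (Fin.cons_inj.1 e).2
        · rw [spbwMon_cons]
      | zero => simp
      | add b c _ _ hb hc => rw [mul_add]; exact add_mem hb hc
      | neg b _ hb => rw [mul_neg]; exact neg_mem hb
    refine ⟨τ.trans ρ, fun r => ?_⟩
    have e : spbwMon x (Fin.cons a α : Fin (n + 1) → ℕ) * ι r -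
          ι ((τ.trans ρ) r) * spbwMon x (Fin.cons a α : Fin (n + 1) → ℕ) =
        x 0 ^ a * (spbwMon (Fin.tail x) α * ι r - ι (τ r) * spbwMon (Fin.tail x) α) +
          (x 0 ^ a * ι (τ r) - ι (ρ (τ r)) * x 0 ^ a) * spbwMon (Fin.tail x) α := by
      rw [spbwMon_cons, AddEquiv.trans_apply]
      noncomm_ring
    rw [e]
    exact add_mem (pow_mul_lower _ (hτ r)) (lower_of_le α le_rfl _ (hρ _))

end Monomials

/-- An additive map on finitely supported functions which is unitriangular, up to additive
bijections on the diagonal, with respect to an additive equivalence is bijective. -/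
theorem Finsupp.bijective_of_triangular {P M N : Type*} [PartialOrder P] [WellFoundedLT P]
    [AddCommGroup M] [AddCommGroup N] (L : (P →₀ M) ≃+ N) (T : (P →₀ M) →+ N)
    (τ : P → M ≃+ M)
    (h : ∀ p m, T (single p m) - L (single p (τ p m)) ∈
      AddSubgroup.closure {a | ∃ q < p, ∃ s, a = L (single q s)}) :
    Function.Bijective T := by
  classical
  constructor
  · rw [injective_iff_map_eq_zero]
    intro c hc
    by_contra hne
    obtain ⟨p, hp⟩ := c.support.exists_maximal (support_nonempty_iff.2 hne)
    have coeff_zero : ∀ q, ¬ p < q → ∀ a ∈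
        AddSubgroup.closure {a | ∃ p < q, ∃ s, a = L (single p s)}, L.symm a p = 0 := by
      intro q hq a ha
      induction ha using AddSubgroup.closure_induction with
      | mem a ha =>
        obtain ⟨p', hp', s, rfl⟩ := ha
        rw [L.symm_apply_apply, single_apply, if_neg]
        rintro rfl
        exact hq hp'
      | zero => simp
      | add a b _ _ ha hb => simp [ha, hb]
      | neg a _ ha => simp [ha]
    have coeff : ∀ q ∈ c.support,
        L.symm (T (single q (c q))) p = if q = p then τ p (c p) else 0 := by
      intro q hq
      have := coeff_zero q (fun hlt => hp.not_gt hq hlt) _ (h q (c q))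
      rw [map_sub, L.symm_apply_apply, sub_apply, sub_eq_zero, single_apply] at this
      rw [this]
      split_ifs with hqp
      · rw [hqp]
      · rfl
    have hsum : L.symm (T c) p = τ p (c p) := by
      conv_lhs => rw [← c.sum_single, Finsupp.sum]
      rw [map_sum, map_sum, finsetSum_apply, Finset.sum_congr rfl coeff, Finset.sum_ite_eq',
        if_pos hp.prop]
    rw [hc, map_zero, zero_apply] at hsum
    exact mem_support_iff.1 hp.prop ((τ p).map_eq_zero_iff.1 hsum.symm)
  · have single_mem : ∀ p m, L (single p m) ∈ T.range := by
      intro p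
      induction p using WellFoundedLT.induction with
      | ind p ih =>
        intro m
        have hle : AddSubgroup.closure {a | ∃ q < p, ∃ s, a = L (single q s)} ≤ T.range := by
          rw [AddSubgroup.closure_le]
          rintro _ ⟨q, hq, s, rfl⟩
          exact ih q hq s
        have := sub_mem (AddMonoidHom.mem_range.2 ⟨single p ((τ p).symm m), rfl⟩)
          (hle (h p ((τ p).symm m)))
        rwa [sub_sub_cancel, AddEquiv.apply_symm_apply] at this
    intro a
    obtain ⟨c, rfl⟩ := L.surjective a
    change L c ∈ T.range
    induction c using Finsupp.induction_linear with
    | zero => simp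
    | add c d hc hd => rw [map_add]; exact add_mem hc hd
    | single p m => exact single_mem p m

section LinearCombinations

variable {k R A P : Type*} [CommRing k] [Ring R] [Algebra k R] [Ring A] [Algebra k A]

/-- The map sending a family of coefficients `c` to `∑ c p * v p`. -/
def leftCombination (ι : R →ₐ[k] A) (v : P → A) : (P →₀ R) →ₗ[k] A :=
  Finsupp.lsum k fun p => LinearMap.mulRight k (v p) ∘ₗ ι.toLinearMap

theorem leftCombination_apply (ι : R →ₐ[k] A) (v : P → A) (c : P →₀ R) :
    leftCombination ι v c = c.sum fun p r => ι r * v p := by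
  simp [leftCombination, Finsupp.sum]

theorem leftCombination_single (ι : R →ₐ[k] A) (v : P → A) (p : P) (r : R) :
    leftCombination ι v (Finsupp.single p r) = ι r * v p := by
  simp [leftCombination]

theorem leftCombination_tensor_bijective {S B Q : Type*} [Ring S] [Algebra k S] [Ring B]
    [Algebra k B] {ι : R →ₐ[k] A} {v : P → A} {κ : S →ₐ[k] B} {w : Q → B}
    (hv : Function.Bijective (leftCombination ι v))
    (hw : Function.Bijective (leftCombination κ w)) :
    Function.Bijective (leftCombination (Algebra.TensorProduct.map ι κ)
      fun p : P × Q => v p.1 ⊗ₜ[k] w p.2) := by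
  classical
  let E := (finsuppTensorFinsupp k k R S P Q).symm ≪≫ₗ
    TensorProduct.congr (LinearEquiv.ofBijective _ hv) (LinearEquiv.ofBijective _ hw)
  have : leftCombination (Algebra.TensorProduct.map ι κ)
      (fun p : P × Q => v p.1 ⊗ₜ[k] w p.2) = E.toLinearMap := by
    ext ⟨p, q⟩ r s
    simp [E, leftCombination_single]
  rw [this]
  exact E.bijective

theorem leftCombination_comp_equiv_bijective {Q : Type*} {ι : R →ₐ[k] A} {v : P → A}
    (hv : Function.Bijective (leftCombination ι v)) (e : Q ≃ P) :
    Function.Bijective (leftCombination ι fun q => v (e q)) := by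
  have : leftCombination ι (fun q => v (e q)) =
      leftCombination ι v ∘ₗ (Finsupp.domLCongr e : (Q →₀ R) ≃ₗ[k] (P →₀ R)).toLinearMap := by
    ext q r
    simp [leftCombination_single]
  rw [this]
  exact hv.comp (LinearEquiv.bijective _)

theorem IsSkewPBWExtension.leftCombination_bijective {n : ℕ} {ι : R →ₐ[k] A} {x : Fin n → A}
    (h : IsSkewPBWExtension ι.toRingHom x) :
    Function.Bijective (leftCombination ι (spbwMon x)) := by
  rw [Function.bijective_iff_existsUnique]
  intro f
  obtain ⟨c, hc, huniq⟩ := h.repr_unique f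
  refine ⟨c, (leftCombination_apply ι _ c).trans hc.symm, fun d hd => huniq d ?_⟩
  exact hd.symm.trans (leftCombination_apply ι _ d)

/-- The standard monomials of a bijective skew PBW extension are also a right basis. -/
theorem IsBijectiveSkewPBWExtension.leftCombination_op_bijective {n : ℕ} {ι : R →ₐ[k] A}
    {x : Fin n → A} (h : IsBijectiveSkewPBWExtension ι.toRingHom x) :
    Function.Bijective (leftCombination (AlgHom.op ι) fun α => op (spbwMon x α)) := by
  obtain ⟨hA, σ, δ, -, -, hσ, -, -⟩ := h
  choose τ hτ using exists_spbwMon_mul_sub_mem_spbwLower (ι := ι.toRingHom) x σ δ hσ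
  let L := (LinearEquiv.ofBijective _ hA.leftCombination_bijective).toAddEquiv
  have hL : ∀ α r, L (Finsupp.single α r) = ι r * spbwMon x α :=
    fun α r => leftCombination_single ι _ α r
  let o : ((Fin n → ℕ) →₀ R) ≃+ ((Fin n → ℕ) →₀ Rᵐᵒᵖ) := Finsupp.mapRange.addEquiv opAddEquiv
  let T : ((Fin n → ℕ) →₀ R) →+ A := (opAddEquiv.symm : Aᵐᵒᵖ ≃+ A).toAddMonoidHom.comp
    ((leftCombination (AlgHom.op ι) fun α => op (spbwMon x α)).toAddMonoidHom.comp
      o.toAddMonoidHom)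
  have hT : ∀ α r, T (Finsupp.single α r) = spbwMon x α * ι r := by
    intro α r
    simp [T, o, leftCombination_single]
  have bij : Function.Bijective T := by
    refine Finsupp.bijective_of_triangular L T τ fun α r => ?_
    simp only [hL, hT]
    exact hτ α r
  have : ⇑(leftCombination (AlgHom.op ι) fun α => op (spbwMon x α)) =
      opAddEquiv ∘ T ∘ o.symm := by
    ext c
    simp [T]
  rw [this]
  exact opAddEquiv.bijective.comp (bij.comp o.symm.bijective)

end LinearCombinations

/-- If `A` is a bijective skew PBW extension over `R`, where
`A` and `R` are algebras over a commutative ring `k`, then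
`Aᵉ = A ⊗[k] Aᵐᵒᵖ` is a free left `R ⊗[k] Rᵐᵒᵖ`-module with basis
`Mon(Aᵉ) = {(x₁⊗1)^{α₁}⋯(xₙ⊗1)^{αₙ}(1⊗xₙ)^{α_{n+1}}⋯(1⊗x₁)^{α_{2n}}}`: every
element has a unique representation as a left `R ⊗[k] Rᵐᵒᵖ`-combination of
these monomials. -/
theorem enveloping_free_basis {k R A : Type*} [CommRing k]
    [Ring R] [Algebra k R] [Ring A] [Algebra k A] {n : ℕ}
    (ι : R →ₐ[k] A) (x : Fin n → A)
    (h : IsBijectiveSkewPBWExtension ι.toRingHom x) :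
    ∀ f : A ⊗[k] Aᵐᵒᵖ, ∃! cc : (Fin (n + n) → ℕ) →₀ (R ⊗[k] Rᵐᵒᵖ),
      f = cc.sum fun α r =>
        (Algebra.TensorProduct.map ι (AlgHom.op ι)) r *
          spbwMon (Fin.append (fun i => x i ⊗ₜ[k] (1 : Aᵐᵒᵖ))
            (fun i => (1 : A) ⊗ₜ[k] op (x i.rev))) α := by
  let e : (Fin (n + n) → ℕ) ≃ (Fin n → ℕ) × (Fin n → ℕ) :=
    (Fin.appendEquiv n n).symm.trans
      (Equiv.prodCongr (Equiv.refl _) (Equiv.arrowCongr Fin.revPerm (Equiv.refl _)))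
  have mon : ∀ γ, spbwMon x (e γ).1 ⊗ₜ[k] op (spbwMon x (e γ).2) =
      spbwMon (Fin.append (fun i => x i ⊗ₜ[k] (1 : Aᵐᵒᵖ))
        (fun i => (1 : A) ⊗ₜ[k] op (x i.rev))) γ := by
    intro γ
    obtain ⟨⟨α, β⟩, rfl⟩ := e.symm.surjective γ
    have he : e.symm (α, β) = Fin.append α fun i => β i.rev := rfl
    rw [Equiv.apply_symm_apply, he, spbwMon_append]
    have h₁ := map_spbwMon
      (Algebra.TensorProduct.includeLeft : A →ₐ[k] A ⊗[k] Aᵐᵒᵖ).toRingHom x α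
    have h₂ := map_spbwMon (Algebra.TensorProduct.includeRight : Aᵐᵒᵖ →ₐ[k] A ⊗[k] Aᵐᵒᵖ).toRingHom
      (fun i => op (x i.rev)) (fun i => β i.rev)
    simp only [AlgHom.toRingHom_eq_coe, RingHom.coe_coe,
      Algebra.TensorProduct.includeLeft_apply, Algebra.TensorProduct.includeRight_apply] at h₁ h₂
    rw [← h₁, ← h₂, spbwMon_op_rev]
    simp
  have bij := leftCombination_comp_equiv_bijective
    (leftCombination_tensor_bijective h.1.leftCombination_bijective
      h.leftCombination_op_bijective) e
  simp only [mon] at bij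
  intro f
  obtain ⟨c, hc, huniq⟩ := (Function.bijective_iff_existsUnique _).1 bij f
  simp only [leftCombination_apply] at hc huniq
  exact ⟨c, hc.symm, fun d hd => huniq d hd.symm⟩
end
end

section
/- Let A be a skew PBW extension over R with generators x_1,…,x_n, endomorphisms σ_1,…,σ_n, and constants c_{α,β}. For each pair of monomials x^α, x^β ∈ Mon(A), there exist unique elements c_{α,β} ∈ R and p_{α,β} ∈ A such that x^α·x^β = c_{α,β}·x^{α+β} + p_{α,β}, where c_{α,β} is left invertible and p_{α,β} = 0 or deg(p_{α,β}) < |α + β|. -/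
open scoped TensorProduct
open MulOpposite

noncomputable section

/-- The set of elements of `A` which are (possibly empty) left
`R`-combinations of standard monomials of total degree `< d`; an element lies
here iff it is `0` or has degree `< d`. -/
def spbwDegLT {R A : Type*} [Ring R] [Ring A] {n : ℕ} (ι : R →+* A)
    (x : Fin n → A) (d : ℕ) : Set A :=
  {a : A | ∃ c : (Fin n → ℕ) →₀ R, (∀ β ∈ c.support, ∑ i, β i < d) ∧
    a = c.sum fun β r => ι r * spbwMon x β}

/-- The additive subgroup of `A` generated by the left multiples of standard monomials of total
degree `< d`. -/
def spbwFiltration {R A : Type*} [Ring R] [Ring A] {n : ℕ} (ι : R →+* A) (x : Fin n → A)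
    (d : ℕ) : AddSubgroup A :=
  AddSubgroup.closure {a | ∃ (r : R) (α : Fin n → ℕ), ∑ i, α i < d ∧ a = ι r * spbwMon x α}

theorem spbwMon_succ {A : Type*} [Ring A] {n : ℕ} (x : Fin (n + 1) → A) (α : Fin (n + 1) → ℕ) :
    spbwMon x α = x 0 ^ α 0 * spbwMon (fun i => x i.succ) (fun i => α i.succ) := by
  simp [spbwMon, List.ofFn_succ]

theorem spbwMon_zero {A : Type*} [Ring A] {n : ℕ} (x : Fin n → A) : spbwMon x 0 = 1 := by
  simp [spbwMon]

theorem mul_spbwMon_of_forall_lt {A : Type*} [Ring A] {n : ℕ} (x : Fin n → A) (α : Fin n → ℕ)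
    (j : Fin n) (hα : ∀ k < j, α k = 0) :
    x j * spbwMon x α = spbwMon x (α + Pi.single j 1) := by
  induction n with
  | zero => exact j.elim0
  | succ n ih =>
    rw [spbwMon_succ, spbwMon_succ]
    refine Fin.cases (fun _ => ?_) (fun j hα => ?_) j hα
    · have h1 : (fun i : Fin n => (α + Pi.single 0 1 : Fin (n + 1) → ℕ) i.succ) = fun i => α i.succ := by
        ext i; simp
      rw [h1, ← mul_assoc, ← pow_succ']
      simp
    · have h1 : (fun i : Fin n => (α + Pi.single j.succ 1 : Fin (n + 1) → ℕ) i.succ)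
          = (fun i => α i.succ) + Pi.single j 1 := by
        ext i; simp [Pi.single_apply]
      have h0 : α 0 = 0 := hα 0 (Fin.succ_pos j)
      rw [h1, ← ih (fun i => x i.succ) (fun i => α i.succ) j
        fun k hk => hα _ (Fin.succ_lt_succ_iff.2 hk)]
      simp [h0]

theorem spbwMon_single {A : Type*} [Ring A] {n : ℕ} (x : Fin n → A) (j : Fin n) :
    spbwMon x (Pi.single j 1) = x j := by
  have := mul_spbwMon_of_forall_lt x 0 j (by simp)
  simpa [spbwMon_zero] using this.symm

theorem sum_add_single_one {n : ℕ} (α : Fin n → ℕ) (j : Fin n) :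
    ∑ i, (α + Pi.single j 1 : Fin n → ℕ) i = ∑ i, α i + 1 := by
  simp [Finset.sum_add_distrib]

theorem exists_eq_add_single_one {n : ℕ} {α : Fin n → ℕ} {j : Fin n} (hj : α j ≠ 0) :
    ∃ β : Fin n → ℕ, α = β + Pi.single j 1 := by
  refine ⟨α - Pi.single j 1, (tsub_add_cancel_of_le fun k => ?_).symm⟩
  obtain rfl | hk := eq_or_ne k j
  · simpa using Nat.one_le_iff_ne_zero.2 hj
  · simp [hk]

section Filtration

variable {R A : Type*} [Ring R] [Ring A] {n : ℕ} {ι : R →+* A} {x : Fin n → A}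

theorem mul_spbwMon_mem_spbwFiltration (r : R) {α : Fin n → ℕ} {d : ℕ} (hα : ∑ i, α i < d) :
    ι r * spbwMon x α ∈ spbwFiltration ι x d :=
  AddSubgroup.subset_closure ⟨r, α, hα, rfl⟩

theorem spbwMon_mem_spbwFiltration {α : Fin n → ℕ} {d : ℕ} (hα : ∑ i, α i < d) :
    spbwMon x α ∈ spbwFiltration ι x d := by
  simpa using mul_spbwMon_mem_spbwFiltration (ι := ι) (x := x) 1 hα

theorem spbwFiltration_mono {d e : ℕ} (hde : d ≤ e) :
    spbwFiltration ι x d ≤ spbwFiltration ι x e :=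
  AddSubgroup.closure_mono fun _ ⟨r, α, hα, ha⟩ => ⟨r, α, hα.trans_le hde, ha⟩

theorem coeff_mul_mem_spbwFiltration (r : R) {d : ℕ} {a : A} (ha : a ∈ spbwFiltration ι x d) :
    ι r * a ∈ spbwFiltration ι x d := by
  induction ha using AddSubgroup.closure_induction with
  | mem a ha =>
    obtain ⟨s, α, hα, rfl⟩ := ha
    rw [← mul_assoc, ← map_mul]
    exact mul_spbwMon_mem_spbwFiltration _ hα
  | zero => simp
  | add a b _ _ iha ihb => rw [mul_add]; exact add_mem iha ihb
  | neg a _ iha => rw [mul_neg]; exact neg_mem iha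

theorem coeff_mem_spbwFiltration (r : R) {d : ℕ} (hd : 0 < d) : ι r ∈ spbwFiltration ι x d := by
  simpa [spbwMon_zero] using
    mul_spbwMon_mem_spbwFiltration (ι := ι) (x := x) r (α := 0) (d := d) (by simpa using hd)

theorem gen_mem_spbwFiltration (j : Fin n) {d : ℕ} (hd : 1 < d) :
    x j ∈ spbwFiltration ι x d := by
  rw [← spbwMon_single x j]
  exact spbwMon_mem_spbwFiltration (by simpa using hd)

theorem mem_spbwFiltration_iff {d : ℕ} {a : A} :
    a ∈ spbwFiltration ι x d ↔ a ∈ spbwDegLT ι x d := by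
  constructor
  · intro ha
    induction ha using AddSubgroup.closure_induction with
    | mem a ha =>
      obtain ⟨s, α, hα, rfl⟩ := ha
      refine ⟨Finsupp.single α s, fun β hβ => ?_, by simp⟩
      rwa [Finset.mem_singleton.1 (Finsupp.support_single_subset hβ)]
    | zero => exact ⟨0, by simp, by simp⟩
    | add a b _ _ iha ihb =>
      classical
      obtain ⟨c, hc, rfl⟩ := iha
      obtain ⟨e, he, rfl⟩ := ihb
      refine ⟨c + e, fun β hβ => ?_, ?_⟩
      · exact (Finset.mem_union.1 (Finsupp.support_add hβ)).elim (hc β) (he β)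
      · rw [Finsupp.sum_add_index' (by simp) (by simp [add_mul])]
    | neg a _ iha =>
      obtain ⟨c, hc, rfl⟩ := iha
      refine ⟨-c, fun β hβ => hc β (by simpa using hβ), ?_⟩
      rw [Finsupp.sum_neg_index (by simp)]
      simp [Finsupp.sum]
  · rintro ⟨c, hc, rfl⟩
    exact sum_mem fun β hβ => mul_spbwMon_mem_spbwFiltration _ (hc β hβ)

namespace IsSkewPBWExtension

theorem eq_zero_of_mul_spbwMon_mem (h : IsSkewPBWExtension ι x) {r : R} {α : Fin n → ℕ} {d : ℕ}
    (hd : d ≤ ∑ i, α i) (hr : ι r * spbwMon x α ∈ spbwFiltration ι x d) : r = 0 := by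
  obtain ⟨c, hc, hrc⟩ := mem_spbwFiltration_iff.1 hr
  have hsingle : Finsupp.single α r = c :=
    (h.repr_unique (ι r * spbwMon x α)).unique (by simp) hrc
  by_contra hne
  have : α ∈ c.support := by simp [← hsingle, hne]
  exact absurd (hc α this) (not_lt.2 hd)

theorem coeff_eq_of_sub_mem (h : IsSkewPBWExtension ι x) {r s : R} {α : Fin n → ℕ} {d : ℕ}
    (hd : d ≤ ∑ i, α i)
    (hrs : ι r * spbwMon x α - ι s * spbwMon x α ∈ spbwFiltration ι x d) : r = s := by
  rw [← sub_mul, ← map_sub] at hrs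
  exact sub_eq_zero.1 (h.eq_zero_of_mul_spbwMon_mem hd hrs)

theorem exists_gen_mul_coeff (h : IsSkewPBWExtension ι x) (i : Fin n) (r : R) :
    ∃ s t : R, x i * ι r = ι s * x i + ι t := by
  by_cases hr : r = 0
  · exact ⟨0, 0, by simp [hr]⟩
  · obtain ⟨s, -, t, ht⟩ := h.mul_coeff i r hr
    exact ⟨s, t, by rw [ht]; abel⟩

theorem exists_gen_mul_leftInvertible (h : IsSkewPBWExtension ι x) (i : Fin n) {r v : R}
    (hv : v * r = 1) :
    ∃ s t : R, x i * ι r = ι s * x i + ι t ∧ ∃ w : R, w * s = 1 := by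
  obtain ⟨s, t, hst⟩ := h.exists_gen_mul_coeff i r
  obtain ⟨w, z, hwz⟩ := h.exists_gen_mul_coeff i v
  refine ⟨s, t, hst, w, h.coeff_eq_of_sub_mem (α := Pi.single i 1) (d := 1) (by simp) ?_⟩
  have key : x i = ι (w * s) * x i + ι (w * t + z * r) := by
    calc x i = x i * ι v * ι r := by rw [mul_assoc, ← map_mul, hv, map_one, mul_one]
      _ = ι w * (x i * ι r) + ι z * ι r := by rw [hwz, add_mul, mul_assoc]
      _ = _ := by rw [hst]; simp only [map_mul, map_add, mul_add, mul_assoc, add_assoc]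
  have : ι (w * s) * x i - ι 1 * x i = - ι (w * t + z * r) := by
    rw [map_one, one_mul]; nth_rewrite 2 [key]; abel
  rw [spbwMon_single, this]
  exact neg_mem (coeff_mem_spbwFiltration _ one_pos)

theorem spbwSpan_subset_spbwFiltration : spbwSpan ι x ⊆ spbwFiltration ι x 2 := by
  rintro _ ⟨r, c, rfl⟩
  exact add_mem (coeff_mem_spbwFiltration _ two_pos) <| sum_mem fun l _ =>
    coeff_mul_mem_spbwFiltration _ (gen_mem_spbwFiltration l one_lt_two)

theorem exists_gen_mul_gen (h : IsSkewPBWExtension ι x) {i j : Fin n} (hij : i < j) :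
    ∃ c : R, (∃ v, v * c = 1) ∧ x j * x i - ι c * (x i * x j) ∈ spbwSpan ι x := by
  obtain ⟨c, -, hc⟩ := h.mul_gen i j
  obtain ⟨v, -, hv⟩ := h.mul_gen j i
  refine ⟨c, ⟨v, ?_⟩, hc⟩
  have hmon : spbwMon x (Pi.single j 1 + Pi.single i 1) = x i * x j := by
    rw [← mul_spbwMon_of_forall_lt, spbwMon_single]
    intro k hk
    simp [(hk.trans hij).ne]
  refine h.coeff_eq_of_sub_mem (α := Pi.single j 1 + Pi.single i 1) (d := 2)
    (by rw [sum_add_single_one]; simp) ?_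
  have key : ι (v * c) * (x i * x j) - ι 1 * (x i * x j)
      = - (ι v * (x j * x i - ι c * (x i * x j)) + (x i * x j - ι v * (x j * x i))) := by
    simp only [map_mul, map_one, mul_sub, one_mul, mul_assoc]; abel
  rw [hmon, key]
  exact neg_mem (add_mem (coeff_mul_mem_spbwFiltration _ (spbwSpan_subset_spbwFiltration hc))
    (spbwSpan_subset_spbwFiltration hv))

/-- Multiplication by a generator raises the filtration by one as soon as it does so on
standard monomials. -/
theorem gen_mul_mem_of_forall_spbwMon (h : IsSkewPBWExtension ι x) {d : ℕ} (i : Fin n)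
    (hmon : ∀ α : Fin n → ℕ, ∑ k, α k < d → x i * spbwMon x α ∈ spbwFiltration ι x (d + 1))
    {a : A} (ha : a ∈ spbwFiltration ι x d) : x i * a ∈ spbwFiltration ι x (d + 1) := by
  induction ha using AddSubgroup.closure_induction with
  | mem a ha =>
    obtain ⟨r, α, hα, rfl⟩ := ha
    obtain ⟨s, t, hst⟩ := h.exists_gen_mul_coeff i r
    rw [← mul_assoc, hst, add_mul, mul_assoc]
    exact add_mem (coeff_mul_mem_spbwFiltration _ (hmon α hα))
      (mul_spbwMon_mem_spbwFiltration _ (hα.trans (Nat.lt_succ_self d)))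
  | zero => simp
  | add a b _ _ iha ihb => rw [mul_add]; exact add_mem iha ihb
  | neg a _ iha => rw [mul_neg]; exact neg_mem iha

theorem exists_gen_mul_spbwMon (h : IsSkewPBWExtension ι x) (i : Fin n) (α : Fin n → ℕ) :
    ∃ u : R, (∃ v, v * u = 1) ∧
      x i * spbwMon x α - ι u * spbwMon x (α + Pi.single i 1) ∈
        spbwFiltration ι x (∑ k, α k + 1) := by
  induction hd : ∑ k, α k using Nat.strong_induction_on generalizing i α with
  | _ d ih =>
  have gen_mul_mem (l : Fin n) {a : A} (ha : a ∈ spbwFiltration ι x d) :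
      x l * a ∈ spbwFiltration ι x (d + 1) := by
    refine h.gen_mul_mem_of_forall_spbwMon l (fun β hβ => ?_) ha
    obtain ⟨u, -, hu⟩ := ih _ hβ l β rfl
    rw [← sub_add_cancel (x l * spbwMon x β) (ι u * spbwMon x (β + Pi.single l 1))]
    exact add_mem (spbwFiltration_mono (by omega) hu)
      (mul_spbwMon_mem_spbwFiltration _ (by rw [sum_add_single_one]; omega))
  by_cases hi : ∀ k < i, α k = 0
  · exact ⟨1, ⟨1, one_mul 1⟩, by simp [mul_spbwMon_of_forall_lt x α i hi]⟩
  obtain ⟨j, ⟨hji, hj⟩, hmin⟩ : ∃ j, (j < i ∧ α j ≠ 0) ∧ ∀ k < j, α k = 0 := by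
    push Not at hi
    obtain ⟨j, hj, hmin⟩ := WellFounded.has_min (wellFounded_lt (α := Fin n))
      {k | k < i ∧ α k ≠ 0} hi
    exact ⟨j, hj, fun k hk => by_contra fun hk0 => hmin k ⟨hk.trans hj.1, hk0⟩ hk⟩
  obtain ⟨β, rfl⟩ : ∃ β, α = β + Pi.single j 1 := exists_eq_add_single_one hj
  rw [sum_add_single_one] at hd
  have hβ : ∀ k < j, β k = 0 := fun k hk => by simpa [hk.ne] using hmin k hk
  have hβi : ∀ k < j, (β + Pi.single i 1 : Fin n → ℕ) k = 0 := fun k hk => by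
    simp [hβ k hk, (hk.trans hji).ne]
  obtain ⟨c, ⟨c', hc'⟩, r, e, hc⟩ := h.exists_gen_mul_gen hji
  obtain ⟨u, ⟨u', hu'⟩, hu⟩ := ih _ (by omega) i β rfl
  obtain ⟨s, t, hst, s', hs'⟩ := h.exists_gen_mul_leftInvertible j hu'
  refine ⟨c * s, ⟨s' * c', by rw [mul_assoc, ← mul_assoc c', hc', one_mul, hs']⟩, ?_⟩
  have hβd : spbwMon x β ∈ spbwFiltration ι x d := spbwMon_mem_spbwFiltration (by omega)
  have hlow : (x i * x j - ι c * (x j * x i)) * spbwMon x β ∈ spbwFiltration ι x (d + 1) := by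
    rw [hc, add_mul, Finset.sum_mul]
    refine add_mem (mul_spbwMon_mem_spbwFiltration _ (by omega)) (sum_mem fun l _ => ?_)
    rw [mul_assoc]
    exact coeff_mul_mem_spbwFiltration _ (gen_mul_mem l hβd)
  have hrec := coeff_mul_mem_spbwFiltration c
    (gen_mul_mem j (spbwFiltration_mono (by omega) hu))
  have hder : ι (c * t) * spbwMon x (β + Pi.single i 1) ∈ spbwFiltration ι x (d + 1) :=
    mul_spbwMon_mem_spbwFiltration _ (by rw [sum_add_single_one]; omega)
  convert add_mem (add_mem hlow hrec) hder using 1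
  rw [add_right_comm, ← mul_spbwMon_of_forall_lt x β j hβ,
    ← mul_spbwMon_of_forall_lt x _ j hβi, mul_sub (x j), ← mul_assoc (x j) (ι u), hst]
  simp only [map_mul, mul_sub, sub_mul, add_mul, mul_add, mul_assoc]
  abel

theorem gen_mul_mem_spbwFiltration (h : IsSkewPBWExtension ι x) (i : Fin n) {d : ℕ} {a : A}
    (ha : a ∈ spbwFiltration ι x d) : x i * a ∈ spbwFiltration ι x (d + 1) := by
  refine h.gen_mul_mem_of_forall_spbwMon i (fun α hα => ?_) ha
  obtain ⟨u, -, hu⟩ := h.exists_gen_mul_spbwMon i α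
  rw [← sub_add_cancel (x i * spbwMon x α) (ι u * spbwMon x (α + Pi.single i 1))]
  exact add_mem (spbwFiltration_mono (by omega) hu)
    (mul_spbwMon_mem_spbwFiltration _ (by rw [sum_add_single_one]; omega))

theorem exists_spbwMon_mul_spbwMon (h : IsSkewPBWExtension ι x) (α β : Fin n → ℕ) :
    ∃ u : R, (∃ v, v * u = 1) ∧
      spbwMon x α * spbwMon x β - ι u * spbwMon x (α + β) ∈
        spbwFiltration ι x (∑ k, (α + β) k) := by
  induction hd : ∑ k, α k generalizing α with
  | zero =>
    obtain rfl : α = 0 := by ext k; simpa using Finset.sum_eq_zero_iff.1 hd k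
    exact ⟨1, ⟨1, one_mul 1⟩, by simp [spbwMon_zero]⟩
  | succ d ih =>
    obtain ⟨j, hj, hmin⟩ : ∃ j, α j ≠ 0 ∧ ∀ k < j, α k = 0 := by
      have hne : {k | α k ≠ 0}.Nonempty := by
        by_contra hempty
        have hzero : ∀ k, α k = 0 := by simpa [Set.Nonempty] using hempty
        simp [hzero] at hd
      obtain ⟨j, hj, hmin⟩ := WellFounded.has_min (wellFounded_lt (α := Fin n)) _ hne
      exact ⟨j, hj, fun k hk => by_contra fun hk0 => hmin k hk0 hk⟩
    obtain ⟨γ, rfl⟩ : ∃ γ, α = γ + Pi.single j 1 := exists_eq_add_single_one hj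
    rw [sum_add_single_one] at hd
    have hγ : ∀ k < j, γ k = 0 := fun k hk => by simpa [hk.ne] using hmin k hk
    obtain ⟨u, ⟨u', hu'⟩, hu⟩ := ih γ (by omega)
    obtain ⟨s, t, hst, s', hs'⟩ := h.exists_gen_mul_leftInvertible j hu'
    obtain ⟨w, ⟨w', hw'⟩, hw⟩ := h.exists_gen_mul_spbwMon j (γ + β)
    refine ⟨s * w, ⟨w' * s', by rw [mul_assoc, ← mul_assoc s', hs', one_mul, hw']⟩, ?_⟩
    rw [add_right_comm, sum_add_single_one, ← mul_spbwMon_of_forall_lt x γ j hγ]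
    have hder : ι t * spbwMon x (γ + β) ∈ spbwFiltration ι x (∑ k, (γ + β) k + 1) :=
      mul_spbwMon_mem_spbwFiltration _ (Nat.lt_succ_self _)
    convert add_mem (add_mem (h.gen_mul_mem_spbwFiltration j hu)
      (coeff_mul_mem_spbwFiltration s hw)) hder using 1
    rw [mul_sub (x j), ← mul_assoc (x j) (ι u), hst]
    simp only [map_mul, mul_sub, add_mul, mul_assoc]
    abel

end IsSkewPBWExtension

end Filtration

/-- Let `A` be a skew PBW extension over `R` with generators
`x₁,…,xₙ`. For each pair of standard monomials `x^α, x^β`, there exist unique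
elements `c_{α,β} ∈ R` and `p_{α,β} ∈ A` such that
`x^α·x^β = c_{α,β}·x^{α+β} + p_{α,β}`, where `c_{α,β}` is left invertible and
`p_{α,β} = 0` or `deg p_{α,β} < |α + β|`. -/
theorem monomial_mul_monomial {R A : Type*} [Ring R] [Ring A] {n : ℕ}
    (ι : R →+* A) (x : Fin n → A) (h : IsSkewPBWExtension ι x) :
    ∀ α β : Fin n → ℕ, ∃! cp : R × A,
      spbwMon x α * spbwMon x β = ι cp.1 * spbwMon x (α + β) + cp.2 ∧
      (∃ u : R, u * cp.1 = 1) ∧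
      cp.2 ∈ spbwDegLT ι x (∑ i, (α + β) i) := by
  intro α β
  obtain ⟨u, hleft, hu⟩ := h.exists_spbwMon_mul_spbwMon α β
  refine ⟨(u, spbwMon x α * spbwMon x β - ι u * spbwMon x (α + β)),
    ⟨by simp, hleft, mem_spbwFiltration_iff.1 hu⟩, ?_⟩
  rintro ⟨c, p⟩ ⟨heq, -, hp⟩
  obtain rfl : c = u := by
    refine h.coeff_eq_of_sub_mem (α := α + β) le_rfl ?_
    convert sub_mem hu (mem_spbwFiltration_iff.2 hp) using 1
    simp only [heq]
    abel
  simp [heq]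
end
end
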